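/- For every NPLCS N, location q and sets of locations A₁,…,Aₙ ⊆ Q, the following are equivalent: (1) there exists a finite-memory scheduler U with Pr_U((q,ε) ⊨ ⋀_{i=1}^n □◇Aᵢ) > 0; (2) there exists a location x ∈ Q such that (q,ε) →* (x,ε) and there is a finite-memory scheduler V with Pr_V((x,ε) ⊨ ⋀_{i=1}^n □◇Aᵢ) = 1. -/

import Mathlib

open scoped ENNReal
open Classical

namespace NPLCSmodel

/-! ## Lossy channel systems -/

/-- Operations of a lossy channel system: send a message on a channel,
receive a message from a channel, or an internal action. -/
inductive LcsOp (C M : Type) : Type where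
  | send : C → M → LcsOp C M
  | recv : C → M → LcsOp C M
  | internal : LcsOp C M

def LcsOp.IsRecv {C M : Type} : LcsOp C M → Prop
  | .recv _ _ => True
  | _ => False

/-- A transition rule `src --op--> dst`. -/
structure LcsRule (Q C M : Type) : Type where
  src : Q
  op : LcsOp C M
  dst : Q

/-- Channel contents: a word over `M` for each channel. -/
abbrev Chans (C M : Type) : Type := C → List M

/-- Configurations: a location together with channel contents. -/
abbrev Conf (Q C M : Type) : Type := Q × Chans C M

/-- The empty channel contents ε. -/
def eps (C M : Type) : Chans C M := fun _ => []

variable {Q C M : Type}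

/-- When is an operation possible on channel contents `w`? -/
def enabledOp : LcsOp C M → Chans C M → Prop
  | .recv c m, w => ∃ v, w c = m :: v
  | .send _ _, _ => True
  | .internal, _ => True

/-- Effect of an operation on the channel contents (for a perfect step). -/
def applyOp [DecidableEq C] : LcsOp C M → Chans C M → Chans C M
  | .send c m, w => Function.update w c (w c ++ [m])
  | .recv c _, w => Function.update w c (w c).tail
  | .internal, w => w

/-- A rule is enabled in a configuration. -/
def LcsRule.EnabledIn (δ : LcsRule Q C M) (s : Conf Q C M) : Prop :=
  δ.src = s.1 ∧ enabledOp δ.op s.2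

/-- A lossy channel system `L = (Q, C, M, Δ)` (the finiteness of the location,
channel and message types is imposed by `Fintype` assumptions at use sites):
a finite set of transition rules such that every location has at least one
outgoing rule that is not a receive. -/
structure LCS (Q C M : Type) : Type where
  rules : Set (LcsRule Q C M)
  finiteRules : rules.Finite
  noDeadlock : ∀ q : Q, ∃ δ ∈ rules, δ.src = q ∧ ¬ δ.op.IsRecv

variable [DecidableEq C]

/-- Lossy step via rule `δ`: a perfect step followed by losing arbitrarily
many messages (`<+` is the (componentwise) subword relation). -/
def LCS.StepVia (L : LCS Q C M) (s : Conf Q C M) (δ : LcsRule Q C M)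
    (t : Conf Q C M) : Prop :=
  δ ∈ L.rules ∧ δ.EnabledIn s ∧ t.1 = δ.dst ∧ ∀ c, List.Sublist (t.2 c) (applyOp δ.op s.2 c)

/-- Lossy step `s → t`. -/
def LCS.Step (L : LCS Q C M) (s t : Conf Q C M) : Prop := ∃ δ, L.StepVia s δ t

/-- Reachability `s →* t`. -/
def LCS.Reach (L : LCS Q C M) : Conf Q C M → Conf Q C M → Prop :=
  Relation.ReflTransGen L.Step

/-- Constrained reachability `s →*_[X) t`: all configurations along the path,
except possibly the last one, have their location in `X`. -/
def LCS.ReachWithin (L : LCS Q C M) (X : Set Q) : Conf Q C M → Conf Q C M → Prop :=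
  Relation.ReflTransGen (fun a b => L.Step a b ∧ a.1 ∈ X)

/-- Constrained reachability `s →*_[X] t`: all configurations along the path,
including `s` and `t`, have their location in `X`. -/
def LCS.ReachConstrained (L : LCS Q C M) (X : Set Q) (s t : Conf Q C M) : Prop :=
  L.ReachWithin X s t ∧ t.1 ∈ X

/-- `X` is safe for `A`. -/
def LCS.IsSafeFor (L : LCS Q C M) (A X : Set Q) : Prop :=
  X ⊆ A ∧ ∀ x ∈ X, ∃ t, L.Step (x, eps C M) t ∧ t.1 ∈ X

/-- `Safe(A)`: the largest set safe for `A` (the union of all such sets). -/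
def LCS.Safe (L : LCS Q C M) (A : Set Q) : Set Q := ⋃₀ {X | L.IsSafeFor A X}

/-- `X` is promising for `A`. -/
def LCS.IsPromisingFor (L : LCS Q C M) (A X : Set Q) : Prop :=
  ∀ x ∈ X, ∃ t, L.ReachWithin X (x, eps C M) t ∧ t.1 ∈ A

/-- `Prom(A)`: the largest set promising for `A` (the union of all such sets). -/
def LCS.Prom (L : LCS Q C M) (A : Set Q) : Set Q := ⋃₀ {X | L.IsPromisingFor A X}

/-! ## NPLCS and the induced Markov decision process -/

/-- An NPLCS: an LCS together with a fault rate `τ ∈ (0,1)`. -/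
structure NPLCS (Q C M : Type) : Type where
  L : LCS Q C M
  τ : ℝ
  τ_pos : 0 < τ
  τ_lt_one : τ < 1

/-- The number of embeddings of the second list as a subword of the first. -/
def countEmb [DecidableEq M] : List M → List M → ℕ
  | _, [] => 1
  | [], _ :: _ => 0
  | a :: v, b :: w => (if a = b then countEmb v w else 0) + countEmb v (b :: w)

variable [Fintype C] [DecidableEq M]

/-- Total number of messages in the channels. -/
def chansSize (w : Chans C M) : ℕ := ∑ c, (w c).length

/-- `P_lost(v,v') = τ^(|v|-|v'|) · (1-τ)^|v'| · C(v,v')`, the probability that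
channel contents `v` become `v'` through message losses. -/
noncomputable def plost (τ : ℝ) (v v' : Chans C M) : ℝ≥0∞ :=
  ENNReal.ofReal
    (τ ^ (chansSize v - chansSize v') * (1 - τ) ^ chansSize v' *
      (∏ c, countEmb (v c) (v' c) : ℕ))

/-- One-step probability `P_N(s, δ, t)` of the MDP of an NPLCS. -/
noncomputable def NPLCS.stepProb (N : NPLCS Q C M) (s : Conf Q C M)
    (δ : LcsRule Q C M) (t : Conf Q C M) : ℝ≥0∞ :=
  if δ ∈ N.L.rules ∧ δ.EnabledIn s ∧ t.1 = δ.dst then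
    plost N.τ (applyOp δ.op s.2) t.2
  else 0

/-! ## Probability measure of a countable-state Markov chain

Given one-step probabilities `k` on a state space `S`, the measure of a set of
trajectories is the Carathéodory outer measure generated by the probabilities
of cylinder sets; it agrees with the usual Markov-chain measure on all
measurable (in particular, on all ω-regular) sets of trajectories. -/

section Chain
variable {S : Type}

/-- Probability that the chain starting in `s` performs the finite sequence
of steps through the configurations listed in `l`. -/
noncomputable def chainPathProb (k : S → S → ℝ≥0∞) : S → List S → ℝ≥0∞
  | _, [] => 1
  | s, t :: l => k s t * chainPathProb k t l

/-- The cylinder of trajectories starting with `s` followed by `l`. -/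
def chainCyl (s : S) (l : List S) : Set (ℕ → S) :=
  {ω | ω 0 = s ∧ ∀ (i : ℕ) (h : i < l.length), ω (i + 1) = l.get ⟨i, h⟩}

/-- Premeasure: probability of a cylinder set, `∞` on other (nonempty) sets. -/
noncomputable def chainFun (k : S → S → ℝ≥0∞) (s : S) (A : Set (ℕ → S)) : ℝ≥0∞ :=
  if A = ∅ then 0 else ⨅ (l : List S) (_ : A = chainCyl s l), chainPathProb k s l

theorem chainFun_empty (k : S → S → ℝ≥0∞) (s : S) : chainFun k s ∅ = 0 := by
  simp [chainFun]

/-- The probability, for the Markov chain with one-step probabilities `k`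
started in `s`, of the set `E` of trajectories (paths starting in `s`). -/
noncomputable def chainPr (k : S → S → ℝ≥0∞) (s : S) (E : Set (ℕ → S)) : ℝ≥0∞ :=
  MeasureTheory.OuterMeasure.ofFunction (chainFun k s) (chainFun_empty k s)
    (E ∩ {ω | ω 0 = s})

end Chain

/-! ## Schedulers -/

/-- A (history-dependent, deterministic) scheduler: given the history
`h = s₁ → ⋯ → s_{n-1}` and the current configuration `sₙ`, it chooses a
transition rule of `N` enabled in `sₙ`. -/
structure Scheduler (N : NPLCS Q C M) : Type where
  choose : List (Conf Q C M) → Conf Q C M → LcsRule Q C M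
  choose_mem : ∀ h s, choose h s ∈ N.L.rules
  choose_enabled : ∀ h s, (choose h s).EnabledIn s

variable {N : NPLCS Q C M}

/-- The Markov chain `MC_U` induced by a scheduler: its states are finite
paths, represented as (history, current configuration). -/
noncomputable def Scheduler.kernel (U : Scheduler N) :
    List (Conf Q C M) × Conf Q C M → List (Conf Q C M) × Conf Q C M → ℝ≥0∞ :=
  fun a b =>
    if b.1 = a.1 ++ [a.2] then N.stepProb a.2 (U.choose a.1 a.2) b.2 else 0

/-- `Pr_U(s ⊨ E)`: the probability, under scheduler `U` with starting
configuration `s`, of the set `E` of infinite paths (trajectories of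
configurations). -/
noncomputable def Scheduler.Pr (U : Scheduler N) (s : Conf Q C M)
    (E : Set (ℕ → Conf Q C M)) : ℝ≥0∞ :=
  chainPr U.kernel ([], s) {ω | (fun i => (ω i).2) ∈ E}

/-- Memoryless scheduler: the decision depends only on the current
configuration. -/
def Scheduler.Memoryless (U : Scheduler N) : Prop :=
  ∀ h h' s, U.choose h s = U.choose h' s

/-- Blind scheduler: the decision depends only on the sequence of locations
that have been visited. -/
def Scheduler.Blind (U : Scheduler N) : Prop :=
  ∀ h h' s s', h.map Prod.fst = h'.map Prod.fst → s.1 = s'.1 →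
    U.choose h s = U.choose h' s'

/-- Finite-memory scheduler data: finitely many modes, a starting mode, a
decision rule and a next-mode function. -/
structure FMScheduler (N : NPLCS Q C M) : Type 1 where
  Mode : Type
  modeFin : Fintype Mode
  init : Mode
  D : Mode → Conf Q C M → LcsRule Q C M
  upd : Mode → Conf Q C M → Mode
  D_mem : ∀ u s, D u s ∈ N.L.rules
  D_enabled : ∀ u s, (D u s).EnabledIn s

/-- A scheduler is finite-memory if it is induced by finite-memory data. -/
def Scheduler.FiniteMemory (U : Scheduler N) : Prop :=
  ∃ fm : FMScheduler N, ∀ h s, U.choose h s = fm.D (h.foldl fm.upd fm.init) s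

/-- The Markov chain `MC_U` of a finite-memory scheduler: states are pairs
`s_u` of a configuration `s` and a mode `u`. -/
noncomputable def FMScheduler.kernel (fm : FMScheduler N) :
    Conf Q C M × fm.Mode → Conf Q C M × fm.Mode → ℝ≥0∞ :=
  fun a b =>
    if b.2 = fm.upd a.2 a.1 then N.stepProb a.1 (fm.D a.2 a.1) b.1 else 0

/-- Probability measure of the Markov chain `MC_U` of a finite-memory
scheduler, over trajectories of (configuration, mode) states. -/
noncomputable def FMScheduler.PrMC (fm : FMScheduler N)
    (a : Conf Q C M × fm.Mode) (E : Set (ℕ → Conf Q C M × fm.Mode)) : ℝ≥0∞ :=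
  chainPr fm.kernel a E

/-- Reachability in the Markov chain `MC_U` of a finite-memory scheduler. -/
def FMScheduler.MCReach (fm : FMScheduler N) :
    Conf Q C M × fm.Mode → Conf Q C M × fm.Mode → Prop :=
  Relation.ReflTransGen (fun a b => 0 < fm.kernel a b)

/-- The history (the first `i` configurations) of a trajectory. -/
def histTo (ω : ℕ → Conf Q C M) (i : ℕ) : List (Conf Q C M) :=
  (List.range i).map ω

/-- Almost blind scheduler: there are a scheduler `W` and a blind scheduler
`V` such that from any starting configuration, almost surely the choices of
`U` along the path agree with those of `W` up to some finite time and with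
those of `V` afterwards. -/
def Scheduler.AlmostBlind (U : Scheduler N) : Prop :=
  ∃ W V : Scheduler N, V.Blind ∧ ∀ s : Conf Q C M,
    U.Pr s {ω | ∃ n : ℕ,
      (∀ i ≤ n, U.choose (histTo ω i) (ω i) = W.choose (histTo ω i) (ω i)) ∧
      (∀ i, n < i → U.choose (histTo ω i) (ω i) = V.choose (histTo ω i) (ω i))} = 1

/-! ## LTL-style events on trajectories -/

/-- `□P` -/
def evAlways {α : Type} (P : α → Prop) : Set (ℕ → α) := {ω | ∀ i, P (ω i)}

/-- `◇P` -/
def evEventually {α : Type} (P : α → Prop) : Set (ℕ → α) := {ω | ∃ i, P (ω i)}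

/-- `□◇P` -/
def evInfOften {α : Type} (P : α → Prop) : Set (ℕ → α) :=
  {ω | ∀ n, ∃ i, n ≤ i ∧ P (ω i)}

/-- `◇□P` -/
def evEvAlways {α : Type} (P : α → Prop) : Set (ℕ → α) :=
  {ω | ∃ n, ∀ i, n ≤ i → P (ω i)}

/-- The atomic proposition "the current location belongs to `A`". -/
def inLoc (A : Set Q) : Conf Q C M → Prop := fun s => s.1 ∈ A


/-! ## The trajectory measure of a countable-state Markov chain -/

section ChainMeasure

open MeasureTheory ProbabilityTheory Finset Preorder

variable {T : Type} [Countable T] [MeasurableSpace T] [DiscreteMeasurableSpace T]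

/-- The one-step kernel of a chain, in the form expected by the Ionescu-Tulcea theorem. -/
noncomputable def stepKernel (k : T → T → ℝ≥0∞) (n : ℕ) : Kernel (Iic n → T) T :=
  Kernel.ofFunOfCountable fun x =>
    Measure.sum fun b => k (x ⟨n, mem_Iic.2 le_rfl⟩) b • Measure.dirac b

theorem lintegral_stepKernel (k : T → T → ℝ≥0∞) (n : ℕ) (x : Iic n → T) (f : T → ℝ≥0∞) :
    ∫⁻ b, f b ∂(stepKernel k n x) = ∑' b, k (x ⟨n, mem_Iic.2 le_rfl⟩) b * f b := by
  change ∫⁻ b, f b ∂(Measure.sum fun b => k (x ⟨n, mem_Iic.2 le_rfl⟩) b • Measure.dirac b) = _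
  simp [lintegral_sum_measure]

theorem isMarkovKernel_stepKernel {k : T → T → ℝ≥0∞} (hk : ∀ a, ∑' b, k a b = 1) (n : ℕ) :
    IsMarkovKernel (stepKernel k n) := by
  refine ⟨fun x => ⟨?_⟩⟩
  rw [← lintegral_one, lintegral_stepKernel]
  simp [hk]

/-- `μ` is the law of the chain with transition probabilities `k` started in `s`. -/
structure IsChainLaw (k : T → T → ℝ≥0∞) (s : T) (μ : Measure (ℕ → T)) : Prop where
  isProb : IsProbabilityMeasure μ
  start : ∀ᵐ ω ∂μ, ω 0 = s
  markov : ∀ (n : ℕ) (g : (Iic n → T) → ℝ≥0∞) (f : T → ℝ≥0∞),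
    ∫⁻ ω, g (frestrictLe n ω) * f (ω (n + 1)) ∂μ
      = ∫⁻ ω, g (frestrictLe n ω) * ∑' b, k (ω n) b * f b ∂μ

theorem exists_isChainLaw {k : T → T → ℝ≥0∞} (hk : ∀ a, ∑' b, k a b = 1) (s : T) :
    ∃ μ : Measure (ℕ → T), IsChainLaw k s μ := by
  have := isMarkovKernel_stepKernel hk
  refine ⟨Kernel.traj (X := fun _ => T) (stepKernel k) 0 (fun _ => s), ⟨inferInstance, ?_, ?_⟩⟩
  · have h := Kernel.traj_map_frestrictLe_apply (X := fun _ => T) (κ := stepKernel k) 0 0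
      (fun _ => s)
    rw [Kernel.partialTraj_self, Kernel.id_apply] at h
    have h2 : ∀ᵐ x ∂(Measure.dirac (fun _ : Iic 0 => s)), x ⟨0, mem_Iic.2 le_rfl⟩ = s := by
      rw [ae_dirac_iff (.of_discrete)]
    rw [← h] at h2
    exact ae_of_ae_map (by fun_prop) h2
  · intro n g f
    have h := Kernel.partialTraj_compProd_eq_map_traj (X := fun _ => T) (κ := stepKernel k)
      (Nat.zero_le n) (x₀ := fun _ => s)
    have h1 := congrArg (fun ν => ∫⁻ p, g p.1 * f p.2 ∂ν) h
    have mg : Measurable fun p : (Iic n → T) × T => g p.1 * f p.2 := .of_discrete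
    rw [Measure.lintegral_compProd mg, lintegral_map mg (by fun_prop)] at h1
    rw [← h1]
    simp_rw [lintegral_const_mul _ (Measurable.of_discrete (f := f)), lintegral_stepKernel]
    rw [← Kernel.traj_map_frestrictLe_apply, lintegral_map .of_discrete (by fun_prop)]
    rfl

omit [Countable T] [DiscreteMeasurableSpace T] in
theorem IsChainLaw.markov_dependsOn {k : T → T → ℝ≥0∞} {s : T} {μ : Measure (ℕ → T)}
    (h : IsChainLaw k s μ) (n : ℕ) (G : (ℕ → T) → ℝ≥0∞)
    (hG : ∀ ω ω', (∀ i ≤ n, ω i = ω' i) → G ω = G ω') (f : T → ℝ≥0∞) :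
    ∫⁻ ω, G ω * f (ω (n + 1)) ∂μ = ∫⁻ ω, G ω * ∑' b, k (ω n) b * f b ∂μ := by
  have key : ∀ ω : ℕ → T, (fun x : Iic n → T =>
      G fun i => x ⟨min i n, mem_Iic.2 (min_le_right _ _)⟩) (frestrictLe n ω) = G ω := by
    intro ω
    refine hG _ _ fun i hi => ?_
    simp [frestrictLe, min_eq_left hi]
  have := h.markov n (fun x => G fun i => x ⟨min i n, mem_Iic.2 (min_le_right _ _)⟩) f
  simpa only [key] using this

theorem chainPathProb_concat {S : Type} (k : S → S → ℝ≥0∞) (s : S) (l : List S) (b : S) :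
    chainPathProb k s (l ++ [b]) = chainPathProb k s l * k (l.getLastD s) b := by
  induction l generalizing s with
  | nil => simp [chainPathProb]
  | cons t l ih => rw [List.cons_append, chainPathProb, ih, chainPathProb, List.getLastD_cons,
      mul_assoc]

theorem chainCyl_nil {S : Type} (s : S) : chainCyl s [] = {ω | ω 0 = s} := by
  simp [chainCyl]

theorem chainCyl_concat {S : Type} (s : S) (l : List S) (b : S) :
    chainCyl s (l ++ [b]) = chainCyl s l ∩ {ω | ω (l.length + 1) = b} := by
  ext ω
  simp only [chainCyl, Set.mem_inter_iff, Set.mem_ofPred_eq, List.get_eq_getElem,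
    List.length_append, List.length_singleton, and_assoc]
  refine and_congr_right fun _ => ⟨fun h => ⟨fun i hi => ?_, ?_⟩, fun h i hi => ?_⟩
  · rw [h i (by omega), List.getElem_append_left hi]
  · rw [h l.length (by omega)]; simp
  · rcases Nat.lt_succ_iff_lt_or_eq.1 hi with h1 | rfl
    · rw [h.1 i h1, List.getElem_append_left h1]
    · rw [h.2]; simp

theorem apply_length_of_mem_chainCyl {S : Type} {s : S} {l : List S} {ω : ℕ → S}
    (h : ω ∈ chainCyl s l) : ω l.length = l.getLastD s := by
  induction l using List.reverseRecOn with
  | nil => simpa [chainCyl_nil] using h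
  | append_singleton l b _ =>
    rw [chainCyl_concat] at h
    simpa using h.2

theorem mem_chainCyl_congr {S : Type} {s : S} {l : List S} {ω ω' : ℕ → S}
    (h : ∀ i ≤ l.length, ω i = ω' i) : ω ∈ chainCyl s l ↔ ω' ∈ chainCyl s l := by
  simp only [chainCyl, Set.mem_ofPred_eq, h 0 (Nat.zero_le _)]
  refine and_congr_right fun _ => forall₂_congr fun i hi => ?_
  rw [h (i + 1) hi]

omit [Countable T] in
theorem measurableSet_coord (n : ℕ) (P : T → Prop) : MeasurableSet {ω : ℕ → T | P (ω n)} := by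
  have h : MeasurableSet {x : T | P x} := .of_discrete
  exact measurable_pi_apply n h

omit [Countable T] in
theorem measurableSet_chainCyl (s : T) (l : List T) : MeasurableSet (chainCyl s l) := by
  induction l using List.reverseRecOn with
  | nil => rw [chainCyl_nil]; exact measurableSet_coord 0 (· = s)
  | append_singleton l b ih =>
    rw [chainCyl_concat]
    exact ih.inter (measurableSet_coord (l.length + 1) (· = b))

omit [Countable T] in
theorem IsChainLaw.measure_chainCyl {k : T → T → ℝ≥0∞} {s : T} {μ : Measure (ℕ → T)}
    (h : IsChainLaw k s μ) (l : List T) : μ (chainCyl s l) = chainPathProb k s l := by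
  have := h.isProb
  induction l using List.reverseRecOn with
  | nil =>
    rw [chainCyl_nil, chainPathProb]
    exact (measure_congr (Filter.eventuallyEq_univ.2 h.start)).trans measure_univ
  | append_singleton l b ih =>
    rw [chainPathProb_concat, ← ih]
    have h1 := h.markov_dependsOn l.length ((chainCyl s l).indicator 1)
      (fun ω ω' hω => by
        by_cases hm : ω ∈ chainCyl s l
        · simp [hm, (mem_chainCyl_congr hω).1 hm]
        · simp [hm, mt (mem_chainCyl_congr hω).2 hm]) (Set.indicator {b} 1)
    have e1 : ∀ ω : ℕ → T, (chainCyl s l).indicator 1 ω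
        * (Set.indicator {b} 1 (ω (l.length + 1)) : ℝ≥0∞)
        = (chainCyl s (l ++ [b])).indicator 1 ω := by
      intro ω
      rw [chainCyl_concat]
      by_cases h1 : ω ∈ chainCyl s l <;> by_cases h2 : ω (l.length + 1) = b <;> simp [h1, h2]
    have e2 : ∀ ω : ℕ → T, (chainCyl s l).indicator 1 ω
        * ∑' c, k (ω l.length) c * (Set.indicator {b} 1 c : ℝ≥0∞)
        = (chainCyl s l).indicator 1 ω * k (l.getLastD s) b := by
      intro ω
      by_cases h1 : ω ∈ chainCyl s l
      · rw [tsum_eq_single b (fun c hc => by simp [hc]), apply_length_of_mem_chainCyl h1]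
        simp
      · simp [h1]
    simp only [e1, e2] at h1
    rw [lintegral_indicator_one (measurableSet_chainCyl _ _), lintegral_mul_const _
      (measurable_one.indicator (measurableSet_chainCyl _ _)),
      lintegral_indicator_one (measurableSet_chainCyl _ _)] at h1
    exact h1

omit [Countable T] in
theorem IsChainLaw.le_chainFun {k : T → T → ℝ≥0∞} {s : T} {μ : Measure (ℕ → T)}
    (h : IsChainLaw k s μ) (E : Set (ℕ → T)) : μ E ≤ chainFun k s E := by
  unfold chainFun
  split_ifs with hE
  · simp [hE]
  · refine le_iInf₂ fun l hl => ?_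
    rw [hl, h.measure_chainCyl]

theorem chainFun_chainCyl_le {S : Type} (k : S → S → ℝ≥0∞) (s : S) (l : List S) :
    chainFun k s (chainCyl s l) ≤ chainPathProb k s l := by
  unfold chainFun
  split_ifs
  · simp
  · exact (iInf_le _ l).trans (iInf_le _ rfl)

/-- The lists `l` for which `chainCyl s l` is a maximal cylinder inside `U`. -/
def maximalCyls {S : Type} (s : S) (U : Set (ℕ → S)) : Set (List S) :=
  {l | chainCyl s l ⊆ U ∧ ∀ l', l' <+: l → chainCyl s l' ⊆ U → l' = l}

theorem mem_chainCyl_iff_eq {S : Type} {s : S} {l : List S} {ω : ℕ → S} :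
    ω ∈ chainCyl s l ↔ ω 0 = s ∧ l = (List.range l.length).map fun i => ω (i + 1) := by
  simp only [chainCyl, Set.mem_ofPred_eq]
  refine and_congr_right fun _ => ⟨fun h => List.ext_getElem (by simp) fun i h1 h2 => ?_,
    fun h i hi => ?_⟩
  · simp [h i h1]
  · rw [List.get_eq_getElem, List.getElem_of_eq h]; simp

theorem pairwiseDisjoint_maximalCyls {S : Type} (s : S) (U : Set (ℕ → S)) :
    (maximalCyls s U).PairwiseDisjoint (chainCyl s) := by
  have key : ∀ l ∈ maximalCyls s U, ∀ l' ∈ maximalCyls s U, ∀ ω, ω ∈ chainCyl s l →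
      ω ∈ chainCyl s l' → l.length ≤ l'.length → l = l' := by
    intro l hl l' hl' ω h1 h2 hle
    refine hl'.2 l ?_ hl.1
    rw [(mem_chainCyl_iff_eq.1 h1).2, (mem_chainCyl_iff_eq.1 h2).2]
    refine List.IsPrefix.map _ ?_
    rw [List.prefix_iff_eq_take, List.length_range, List.take_range, min_eq_left hle]
  intro l hl l' hl' hne
  refine Set.disjoint_left.2 fun ω h1 h2 => hne ?_
  rcases le_total l.length l'.length with h | h
  · exact key l hl l' hl' ω h1 h2 h
  · exact (key l' hl' l hl ω h2 h1 h).symm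

theorem iUnion_maximalCyls {S : Type} [TopologicalSpace S] [DiscreteTopology S] (s : S)
    {U : Set (ℕ → S)} (hU : IsOpen U) :
    ⋃ l ∈ maximalCyls s U, chainCyl s l = U ∩ {ω | ω 0 = s} := by
  apply Set.Subset.antisymm
  · exact Set.iUnion₂_subset fun l hl => Set.subset_inter hl.1 fun ω hω => hω.1
  rintro ω ⟨hωU, hω⟩
  let p : ℕ → List S := fun n => (List.range n).map fun i => ω (i + 1)
  have hp : ∀ n, ω ∈ chainCyl s (p n) := fun n =>
    mem_chainCyl_iff_eq.2 ⟨hω, by simp [p]⟩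
  have hex : ∃ n, chainCyl s (p n) ⊆ U := by
    obtain ⟨I, u, hu, hsub⟩ := isOpen_pi_iff.1 hU ω hωU
    refine ⟨I.sup id, fun ω' hω' => hsub fun i hi => ?_⟩
    have hi' : i ≤ I.sup id := Finset.le_sup (f := id) hi
    have : ω' i = ω i := by
      rcases i with _ | i
      · rw [hω'.1]; exact hω.symm
      · have h2 := hω'.2 i (by simpa [p] using hi')
        simpa [p] using h2
    rw [this]
    exact (hu i hi).2
  refine Set.mem_iUnion₂.2 ⟨p (Nat.find hex), ⟨Nat.find_spec hex, fun l' hl' hsub => ?_⟩, hp _⟩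
  have h1 : l' = p l'.length := by
    have hlen := hl'.length_le
    rw [List.prefix_iff_eq_take] at hl'
    rw [hl']
    simp only [p, List.length_map, List.length_range] at hlen
    simp [p, ← List.map_take, List.take_range, hlen]
  refine hl'.eq_of_length (le_antisymm hl'.length_le ?_)
  have : Nat.find hex ≤ l'.length := Nat.find_min' hex (h1 ▸ hsub)
  simpa [p] using this

/-- The probability of the statement is the law of the chain, on all sets of trajectories. -/
theorem IsChainLaw.chainPr_eq {k : T → T → ℝ≥0∞} {s : T} {μ : Measure (ℕ → T)}
    (h : IsChainLaw k s μ) (E : Set (ℕ → T)) : chainPr k s E = μ E := by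
  have := h.isProb
  have hstart : ∀ F : Set (ℕ → T), μ (F ∩ {ω | ω 0 = s}) = μ F := fun F =>
    measure_inter_conull h.start
  apply le_antisymm
  · let _ : TopologicalSpace T := ⊥
    have : DiscreteTopology T := ⟨rfl⟩
    have : BorelSpace T := ⟨by
      rw [borel_eq_top_of_discrete]; exact eq_top_iff.2 fun s _ => .of_discrete⟩
    rw [E.measure_eq_iInf_isOpen μ]
    refine le_iInf₂ fun U hEU => le_iInf fun hU => ?_
    have hc : (maximalCyls s U).Countable := Set.to_countable _
    calc chainPr k s E
        ≤ OuterMeasure.ofFunction (chainFun k s) (chainFun_empty k s) (U ∩ {ω | ω 0 = s}) :=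
          measure_mono (Set.inter_subset_inter_left _ hEU)
      _ ≤ ∑' l : maximalCyls s U,
            OuterMeasure.ofFunction (chainFun k s) (chainFun_empty k s) (chainCyl s l) := by
          rw [← iUnion_maximalCyls s hU]; exact measure_biUnion_le _ hc _
      _ ≤ ∑' l : maximalCyls s U, μ (chainCyl s l) := by
          refine ENNReal.tsum_le_tsum fun l => ?_
          rw [h.measure_chainCyl]
          exact (OuterMeasure.ofFunction_le _).trans (chainFun_chainCyl_le k s l)
      _ = μ (U ∩ {ω | ω 0 = s}) := by
          rw [← iUnion_maximalCyls s hU, measure_biUnion hc (pairwiseDisjoint_maximalCyls s U)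
            fun l _ => measurableSet_chainCyl s l]
      _ = μ U := hstart U
  · have : μ.toOuterMeasure ≤ OuterMeasure.ofFunction (chainFun k s) (chainFun_empty k s) :=
      OuterMeasure.le_ofFunction.2 fun F => h.le_chainFun F
    rw [← hstart E]
    exact this _

omit [Countable T] in
theorem IsChainLaw.measure_inter_step {k : T → T → ℝ≥0∞} {s : T} {μ : Measure (ℕ → T)}
    (h : IsChainLaw k s μ) (n : ℕ) {H : Set (ℕ → T)} (hm : MeasurableSet H)
    (hH : ∀ ω ω', (∀ i ≤ n, ω i = ω' i) → ω ∈ H → ω' ∈ H) (B : Set T) :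
    μ (H ∩ {ω | ω (n + 1) ∈ B}) = ∫⁻ ω in H, ∑' b, k (ω n) b * B.indicator 1 b ∂μ := by
  have h1 := h.markov_dependsOn n (H.indicator 1) (fun ω ω' hω => by
    by_cases hm : ω ∈ H
    · simp [hm, hH ω ω' hω hm]
    · simp [hm, mt (hH ω' ω fun i hi => (hω i hi).symm) hm]) (B.indicator 1)
  have e1 : ∀ ω : ℕ → T, H.indicator 1 ω * (B.indicator 1 (ω (n + 1)) : ℝ≥0∞)
      = (H ∩ {ω | ω (n + 1) ∈ B}).indicator 1 ω := by
    intro ω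
    by_cases h1 : ω ∈ H <;> by_cases h2 : ω (n + 1) ∈ B <;> simp [h1, h2]
  have e2 : ∀ ω : ℕ → T, H.indicator 1 ω * ∑' c, k (ω n) c * (B.indicator 1 c : ℝ≥0∞)
      = H.indicator (fun ω => ∑' c, k (ω n) c * (B.indicator 1 c : ℝ≥0∞)) ω := by
    intro ω
    by_cases h1 : ω ∈ H <;> simp [h1]
  simp only [e1, e2] at h1
  rwa [lintegral_indicator_one (hm.inter (measurableSet_coord (n + 1) (· ∈ B))),
    lintegral_indicator hm] at h1

omit [Countable T] in
theorem IsChainLaw.mul_measure_le_step {k : T → T → ℝ≥0∞} {s : T} {μ : Measure (ℕ → T)}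
    (h : IsChainLaw k s μ) (n : ℕ) {H : Set (ℕ → T)} (hm : MeasurableSet H)
    (hH : ∀ ω ω', (∀ i ≤ n, ω i = ω' i) → ω ∈ H → ω' ∈ H) (B : Set T) {p : ℝ≥0∞}
    (hp : ∀ ω ∈ H, ∃ b ∈ B, p ≤ k (ω n) b) :
    p * μ H ≤ μ (H ∩ {ω | ω (n + 1) ∈ B}) := by
  rw [h.measure_inter_step n hm hH, ← setLIntegral_const]
  refine setLIntegral_mono' hm fun ω hω => ?_
  obtain ⟨b, hb, hpb⟩ := hp ω hω
  refine hpb.trans (le_trans ?_ (ENNReal.le_tsum b))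
  simp [hb]

theorem IsChainLaw.ae_step_pos {k : T → T → ℝ≥0∞} {s : T} {μ : Measure (ℕ → T)}
    (h : IsChainLaw k s μ) : ∀ᵐ ω ∂μ, ∀ n, 0 < k (ω n) (ω (n + 1)) := by
  rw [ae_all_iff]
  intro n
  have key : ∀ a b, k a b = 0 → ∀ᵐ ω ∂μ, ¬ (ω n = a ∧ ω (n + 1) = b) := by
    intro a b hab
    have h1 := h.measure_inter_step n (measurableSet_coord n (· = a))
      (fun ω ω' hω h => (hω n le_rfl).symm.trans h) {b}
    rw [setLIntegral_congr_fun (g := 0) (measurableSet_coord n (· = a))] at h1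
    · rw [ae_iff]
      simp only [not_not]
      refine Eq.trans ?_ (h1.trans (by simp))
      rfl
    · intro ω hω
      have hω : ω n = a := hω
      simp only [Pi.zero_apply, ENNReal.tsum_eq_zero, hω]
      intro c
      by_cases hc : c = b
      · simp [hc, hab]
      · simp [hc]
  have key' : ∀ᵐ ω ∂μ, ∀ p : T × T, k p.1 p.2 = 0 → ¬ (ω n = p.1 ∧ ω (n + 1) = p.2) := by
    rw [ae_all_iff]
    intro p
    by_cases hp : k p.1 p.2 = 0
    · filter_upwards [key p.1 p.2 hp] with ω hω _ using hω
    · simp [hp]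
  filter_upwards [key'] with ω hω
  exact pos_iff_ne_zero.2 fun h0 => hω (ω n, ω (n + 1)) h0 ⟨rfl, rfl⟩

omit [Countable T] in
/-- If the class `a` is visited infinitely often and `b` is reached from `a` in one step with
probability bounded from below, then almost surely `b` is visited infinitely often. -/
theorem IsChainLaw.ae_frequently_step {S : Type} {k : T → T → ℝ≥0∞} {s : T}
    {μ : Measure (ℕ → T)} (h : IsChainLaw k s μ) (φ : T → S) (a b : S) {p : ℝ≥0∞} (hp0 : p ≠ 0)
    (hp : ∀ t, φ t = a → ∃ t', φ t' = b ∧ p ≤ k t t') :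
    ∀ᵐ ω ∂μ, (∃ᶠ n in Filter.atTop, φ (ω n) = a) → ∃ᶠ n in Filter.atTop, φ (ω n) = b := by
  have := h.isProb
  suffices key : ∀ N : ℕ, ∀ᵐ ω ∂μ, (∀ i, N ≤ i → φ (ω i) ≠ b) →
      ∀ᶠ n in Filter.atTop, φ (ω n) ≠ a by
    filter_upwards [ae_all_iff.2 key] with ω hω ha
    by_contra hb
    obtain ⟨N, hN⟩ := Filter.eventually_atTop.1 (Filter.not_frequently.1 hb)
    exact ha (hω N hN)
  intro N
  let H : ℕ → Set (ℕ → T) := fun n =>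
    {ω | φ (ω n) = a} ∩ ⋂ i, {ω | N ≤ i → i ≤ n → φ (ω i) ≠ b}
  let D : ℕ → Set (ℕ → T) := fun n => H n ∩ {ω | ω (n + 1) ∈ {t | φ t = b ∧ N ≤ n}}
  have mH : ∀ n, MeasurableSet (H n) := fun n =>
    (measurableSet_coord n (φ · = a)).inter
      (.iInter fun i => measurableSet_coord i fun t => N ≤ i → i ≤ n → φ t ≠ b)
  have mD : ∀ n, MeasurableSet (D n) := fun n =>
    (mH n).inter (measurableSet_coord (n + 1) fun t => φ t = b ∧ N ≤ n)
  have hD : Pairwise (Function.onFun Disjoint D) := by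
    refine (pairwise_disjoint_on D).2 fun m n hmn => Set.disjoint_left.2 fun ω h1 h2 => ?_
    exact Set.mem_iInter.1 h2.1.2 (m + 1) (h1.2.2.trans (Nat.le_succ m)) hmn h1.2.1
  have hle : ∀ n, p * μ (H (n + N)) ≤ μ (D (n + N)) := by
    intro n
    refine h.mul_measure_le_step _ (mH _) (fun ω ω' hω hm => ⟨?_, ?_⟩) _ fun ω hω => ?_
    · have h1 : φ (ω (n + N)) = a := hm.1
      rwa [hω _ le_rfl] at h1
    · refine Set.mem_iInter.2 fun i h1 h2 => ?_
      rw [← hω i h2]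
      exact Set.mem_iInter.1 hm.2 i h1 h2
    · obtain ⟨t', h1, h2⟩ := hp _ hω.1
      exact ⟨t', ⟨h1, Nat.le_add_left N n⟩, h2⟩
  have hsum : ∑' n, μ (H (n + N)) ≠ ∞ := by
    have h1 : p * ∑' n, μ (H (n + N)) ≤ 1 := by
      rw [← ENNReal.tsum_mul_left]
      refine (ENNReal.tsum_le_tsum hle).trans ?_
      rw [← measure_iUnion (f := fun n => D (n + N))
        (fun i j hij => hD (by simpa using hij)) fun n => mD _]
      exact prob_le_one
    intro htop
    rw [htop, ENNReal.mul_top hp0] at h1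
    simp at h1
  filter_upwards [ae_eventually_notMem hsum] with ω hω hb
  obtain ⟨m, hm⟩ := Filter.eventually_atTop.1 hω
  refine Filter.eventually_atTop.2 ⟨m + N, fun n hn ha => hm (n - N) (by omega) ?_⟩
  rw [Nat.sub_add_cancel (by omega)]
  exact ⟨ha, Set.mem_iInter.2 fun i h1 _ => hb i h1⟩

omit [Countable T] in
/-- A nonnegative function with bounded expectation along the chain almost surely does not tend
to infinity. -/
theorem IsChainLaw.ae_frequently_le {k : T → T → ℝ≥0∞} {s : T} {μ : Measure (ℕ → T)}
    (h : IsChainLaw k s μ) (V : T → ℝ≥0∞) {r c : ℝ≥0∞} (hc : c ≠ ∞) (hs : V s ≤ c)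
    (hrc : r * (c + 1) ≤ c) (hV : ∀ t, ∑' b, k t b * V b ≤ r * (V t + 1)) :
    ∀ᵐ ω ∂μ, ∃ K : ℕ, ∃ᶠ n in Filter.atTop, V (ω n) ≤ K := by
  have := h.isProb
  have mV : ∀ n, Measurable fun ω : ℕ → T => V (ω n) := fun n =>
    (Measurable.of_discrete (f := V)).comp (measurable_pi_apply n)
  have bound : ∀ n, ∫⁻ ω, V (ω n) ∂μ ≤ c := by
    intro n
    induction n with
    | zero =>
      rw [lintegral_congr_ae (g := fun _ => V s) (h.start.mono fun ω hω => by simp [hω])]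
      simpa using hs
    | succ n ih =>
      have h1 := h.markov_dependsOn n 1 (fun _ _ _ => rfl) V
      simp only [Pi.one_apply, one_mul] at h1
      rw [h1]
      calc ∫⁻ ω, ∑' b, k (ω n) b * V b ∂μ ≤ ∫⁻ ω, r * (V (ω n) + 1) ∂μ :=
            lintegral_mono fun ω => hV (ω n)
        _ = r * (∫⁻ ω, V (ω n) ∂μ + 1) := by
            rw [lintegral_const_mul _ ((mV n).add_const 1), lintegral_add_right _ measurable_const]
            simp
        _ ≤ r * (c + 1) := by gcongr
        _ ≤ c := hrc
  have hlim : ∫⁻ ω, Filter.liminf (fun n => V (ω n)) Filter.atTop ∂μ ≠ ∞ := by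
    refine ne_top_of_le_ne_top hc ((lintegral_liminf_le mV).trans ?_)
    exact Filter.liminf_le_of_le (by isBoundedDefault) fun b hb =>
      let ⟨n, hn⟩ := hb.exists; hn.trans (bound n)
  filter_upwards [ae_lt_top (Measurable.liminf mV) hlim] with ω hω
  obtain ⟨K, hK⟩ := ENNReal.exists_nat_gt hω.ne
  exact ⟨K, (Filter.frequently_lt_of_liminf_lt (by isBoundedDefault) hK).mono fun n hn => hn.le⟩

/-- Data making the chain `k` on `T`, started in `s`, a lift along `φ` of the chain `k'` on `S`,
together with a function `V` whose sublevel sets are finite in `S` and that does not drift to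
infinity. -/
structure IsTameLift {S : Type} (k : T → T → ℝ≥0∞) (k' : S → S → ℝ≥0∞) (φ : T → S) (s : T) where
  lift : ∀ t y, 0 < k' (φ t) y → ∃ t', φ t' = y ∧ k' (φ t) y ≤ k t t'
  proj : ∀ t t', 0 < k t t' → 0 < k' (φ t) (φ t')
  prob : ∀ t, ∑' t', k t t' = 1
  V : T → ℝ≥0∞
  r : ℝ≥0∞
  c : ℝ≥0∞
  c_ne_top : c ≠ ∞
  start : V s ≤ c
  stable : r * (c + 1) ≤ c
  drift : ∀ t, ∑' b, k t b * V b ≤ r * (V t + 1)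
  finite : ∀ K : ℕ, (φ '' {t | V t ≤ K}).Finite

/-- Reachability along steps of positive probability. -/
def chainReach {S : Type} (k : S → S → ℝ≥0∞) : S → S → Prop :=
  Relation.ReflTransGen fun a b => 0 < k a b

/-- From every state reachable from `a`, every set `B i` is reachable. -/
def Recurrent {S ι : Type} (k : S → S → ℝ≥0∞) (B : ι → Set S) (a : S) : Prop :=
  ∀ b, chainReach k a b → ∀ i, ∃ c ∈ B i, chainReach k b c

variable {S ι : Type} {k : T → T → ℝ≥0∞} {k' : S → S → ℝ≥0∞} {φ : T → S} {s : T}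
  {μ : Measure (ℕ → T)}

theorem IsTameLift.ae_trajectory [Countable S] (hT : IsTameLift k k' φ s)
    (h : IsChainLaw k s μ) :
    ∀ᵐ ω ∂μ, (∀ m n, m ≤ n → chainReach k' (φ (ω m)) (φ (ω n))) ∧
      (∃ a, ∃ᶠ n in Filter.atTop, φ (ω n) = a) ∧
      ∀ a b, chainReach k' a b → (∃ᶠ n in Filter.atTop, φ (ω n) = a) →
        ∃ᶠ n in Filter.atTop, φ (ω n) = b := by
  have h1 : ∀ᵐ ω ∂μ, ∀ p : S × S, 0 < k' p.1 p.2 → (∃ᶠ n in Filter.atTop, φ (ω n) = p.1) →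
        ∃ᶠ n in Filter.atTop, φ (ω n) = p.2 := by
    rw [ae_all_iff]
    intro p
    by_cases hp : 0 < k' p.1 p.2
    · filter_upwards [h.ae_frequently_step φ p.1 p.2 hp.ne' fun t ht => by
        simpa only [ht] using hT.lift t p.2 (ht ▸ hp)] with ω hω _ using hω
    · simp [hp]
  filter_upwards [h1, h.ae_step_pos,
    h.ae_frequently_le hT.V hT.c_ne_top hT.start hT.stable hT.drift] with ω hω hpos hfreq
  refine ⟨fun m n hmn => ?_, ?_, fun a b hab ha => ?_⟩
  · induction n, hmn using Nat.le_induction with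
    | base => exact .refl
    | succ n _ ih => exact ih.tail (hT.proj _ _ (hpos n))
  · obtain ⟨K, hK⟩ := hfreq
    by_contra! hno
    have h2 := (Filter.eventually_all_finite (hT.finite K)).2 fun a _ => hno a
    obtain ⟨n, hn1, hn2⟩ := (hK.and_eventually h2).exists
    exact hn2 _ ⟨_, hn1, rfl⟩ rfl
  · induction hab with
    | refl => exact ha
    | tail _ hbc ih => exact hω (_, _) hbc ih

theorem IsTameLift.ae_frequently_of_visit [Countable S] (hT : IsTameLift k k' φ s)
    (h : IsChainLaw k s μ) {B : ι → Set S} {a : S} (ha : Recurrent k' B a) :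
    ∀ᵐ ω ∂μ, (∃ m, φ (ω m) = a) → ∀ i, ∃ᶠ n in Filter.atTop, φ (ω n) ∈ B i := by
  filter_upwards [hT.ae_trajectory h] with ω ⟨h1, ⟨b, hb⟩, h3⟩ ⟨m, hm⟩ i
  obtain ⟨n, hn, hnb⟩ := Filter.frequently_atTop.1 hb m
  have hab : chainReach k' a b := by rw [← hm, ← hnb]; exact h1 m n hn
  obtain ⟨c, hc, hbc⟩ := ha b hab i
  exact (h3 b c hbc hb).mono fun n hn => hn ▸ hc

theorem IsTameLift.exists_recurrent [Countable S] (hT : IsTameLift k k' φ s)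
    (h : IsChainLaw k s μ) {B : ι → Set S}
    (hB : μ {ω | ∀ i, ∃ᶠ n in Filter.atTop, φ (ω n) ∈ B i} ≠ 0) :
    ∃ a, chainReach k' (φ s) a ∧ Recurrent k' B a := by
  have hf : ∃ᵐ ω ∂μ, ∀ i, ∃ᶠ n in Filter.atTop, φ (ω n) ∈ B i := frequently_ae_iff.2 hB
  obtain ⟨ω, hω, ⟨h1, ⟨a, ha⟩, h3⟩, h0⟩ :=
    (hf.and_eventually ((hT.ae_trajectory h).and h.start)).exists
  refine ⟨a, ?_, fun b hab i => ?_⟩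
  · obtain ⟨n, hn⟩ := ha.exists
    rw [← hn, ← h0]
    exact h1 0 n (Nat.zero_le n)
  · obtain ⟨m, hm⟩ := (h3 a b hab ha).exists
    obtain ⟨n, hn, hnB⟩ := Filter.frequently_atTop.1 (hω i) m
    exact ⟨_, hnB, hm ▸ h1 m n hn⟩

theorem IsTameLift.measure_pos [Countable S] (hT : IsTameLift k k' φ s)
    (h : IsChainLaw k s μ) {B : ι → Set S} {a : S} (hsa : chainReach k' (φ s) a)
    (ha : Recurrent k' B a) :
    0 < μ {ω | ∀ i, ∃ᶠ n in Filter.atTop, φ (ω n) ∈ B i} := by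
  have hvisit : ∃ n, 0 < μ {ω | φ (ω n) = a} := by
    clear ha
    induction hsa with
    | refl =>
      refine ⟨0, ?_⟩
      have := h.isProb
      have h1 : ∀ᵐ ω ∂μ, φ (ω 0) = φ s := h.start.mono fun ω hω => by rw [hω]
      rw [measure_congr (Filter.eventuallyEq_univ.2 h1), measure_univ]
      exact one_pos
    | @tail b c _ hbc ih =>
      obtain ⟨n, hn⟩ := ih
      refine ⟨n + 1, (ENNReal.mul_pos hbc.ne' hn.ne').trans_le
        ((h.mul_measure_le_step n (measurableSet_coord n (φ · = b)) (fun ω ω' hω hm => ?_)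
          {t | φ t = c} fun ω hω => ?_).trans (measure_mono Set.inter_subset_right))⟩
      · have hm : φ (ω n) = b := hm
        rwa [hω n le_rfl] at hm
      · have hω : φ (ω n) = b := hω
        obtain ⟨t', h1, h2⟩ := hT.lift (ω n) c (hω ▸ hbc)
        exact ⟨t', h1, hω ▸ h2⟩
  obtain ⟨n, hn⟩ := hvisit
  refine hn.trans_le (measure_mono_ae ?_)
  filter_upwards [hT.ae_frequently_of_visit h ha] with ω hω hm using hω ⟨n, hm⟩

theorem IsTameLift.measure_eq_one [Countable S] (hT : IsTameLift k k' φ s)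
    (h : IsChainLaw k s μ) {B : ι → Set S} (ha : Recurrent k' B (φ s)) :
    μ {ω | ∀ i, ∃ᶠ n in Filter.atTop, φ (ω n) ∈ B i} = 1 := by
  have := h.isProb
  have h1 : ∀ᵐ ω ∂μ, ∀ i, ∃ᶠ n in Filter.atTop, φ (ω n) ∈ B i := by
    filter_upwards [hT.ae_frequently_of_visit h ha, h.start] with ω hω h0
    exact hω ⟨0, by rw [h0]⟩
  exact (measure_congr (Filter.eventuallyEq_univ.2 h1)).trans measure_univ

end ChainMeasure

/-! ## Message losses -/

section Losses

omit [DecidableEq C] [Fintype C] in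
theorem countEmb_eq_count (v w : List M) : countEmb v w = v.sublists'.count w := by
  induction v generalizing w with
  | nil => cases w <;> simp [countEmb]
  | cons a v ih =>
    cases w with
    | nil =>
      have h1 : (List.map (List.cons a) v.sublists').count [] = 0 :=
        List.count_eq_zero.2 (by simp)
      rw [List.sublists'_cons, List.count_append, h1, ← ih]
      cases v <;> simp [countEmb]
    | cons b w =>
      rw [countEmb, List.sublists'_cons, List.count_append, ← ih, add_comm]
      congr 1
      split_ifs with hab
      · rw [hab, List.count_map_of_injective _ _ List.cons_injective, ← ih]
      · refine (List.count_eq_zero.2 ?_).symm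
        simp [hab]

omit [DecidableEq C] [Fintype C] in
theorem countEmb_pos_iff {v w : List M} : 0 < countEmb v w ↔ w.Sublist v := by
  rw [countEmb_eq_count, List.count_pos_iff, List.mem_sublists']

/-- Sum of `f` over the subwords of `v`, weighted by the probability of each subword. -/
def lossSum (t : ℝ) (v : List M) (f : List M → ℝ) : ℝ :=
  (v.sublists'.map fun w => t ^ (v.length - w.length) * (1 - t) ^ w.length * f w).sum

omit [DecidableEq M] in
theorem lossSum_cons (t : ℝ) (a : M) (v : List M) (f : List M → ℝ) :
    lossSum t (a :: v) f = t * lossSum t v f + (1 - t) * lossSum t v fun w => f (a :: w) := by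
  simp only [lossSum, List.sublists'_cons, List.map_append, List.sum_append,
    ← List.sum_map_mul_left, List.map_map]
  congr 2
  · refine List.map_congr_left fun w hw => ?_
    have := (List.mem_sublists'.1 hw).length_le
    rw [List.length_cons, Nat.succ_sub this, pow_succ]
    ring
  · refine List.map_congr_left fun w hw => ?_
    simp only [Function.comp_apply, List.length_cons, Nat.succ_sub_succ, pow_succ]
    ring

omit [DecidableEq M] in
theorem lossSum_one (t : ℝ) (v : List M) : lossSum t v (fun _ => 1) = 1 := by
  induction v with
  | nil => simp [lossSum]
  | cons a v ih => rw [lossSum_cons, ih]; ring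

omit [DecidableEq M] in
theorem lossSum_add (t : ℝ) (v : List M) (f g : List M → ℝ) :
    lossSum t v (fun w => f w + g w) = lossSum t v f + lossSum t v g := by
  simp [lossSum, mul_add, List.sum_map_add]

omit [DecidableEq M] in
theorem lossSum_length (t : ℝ) (v : List M) :
    lossSum t v (fun w => (w.length : ℝ)) = (1 - t) * v.length := by
  induction v with
  | nil => simp [lossSum]
  | cons a v ih =>
    simp only [lossSum_cons, List.length_cons, Nat.cast_add, Nat.cast_one, lossSum_add, ih,
      lossSum_one]
    ring

/-- The probability that the channel contents `v` of a single channel become `w`. -/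
def wordLoss (t : ℝ) (v w : List M) : ℝ :=
  t ^ (v.length - w.length) * (1 - t) ^ w.length * countEmb v w

theorem wordLoss_nonneg {t : ℝ} (h0 : 0 < t) (h1 : t < 1) (v w : List M) : 0 ≤ wordLoss t v w := by
  have : 0 < 1 - t := by linarith
  unfold wordLoss
  positivity

theorem sum_wordLoss (t : ℝ) (v : List M) (f : List M → ℝ) :
    ∑ w ∈ v.sublists'.toFinset, wordLoss t v w * f w = lossSum t v f := by
  rw [lossSum, Finset.sum_list_map_count]
  refine Finset.sum_congr rfl fun w _ => ?_
  rw [wordLoss, countEmb_eq_count, nsmul_eq_mul, mul_right_comm, mul_comm]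
  congr!

/-- The channel contents that can result from `v` by message losses. -/
def lossy (v : Chans C M) : Finset (Chans C M) :=
  Fintype.piFinset fun c => (v c).sublists'.toFinset

theorem mem_lossy {v v' : Chans C M} : v' ∈ lossy v ↔ ∀ c, (v' c).Sublist (v c) := by
  simp [lossy]

theorem plost_eq_zero (t : ℝ) {v v' : Chans C M} (h : v' ∉ lossy v) : plost t v v' = 0 := by
  rw [mem_lossy] at h
  push Not at h
  obtain ⟨c, hc⟩ := h
  have : countEmb (v c) (v' c) = 0 := by
    rw [← countEmb_pos_iff] at hc
    omega
  rw [plost, Finset.prod_eq_zero (Finset.mem_univ c) this]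
  simp

theorem plost_eq_prod (t : ℝ) {v v' : Chans C M} (h : v' ∈ lossy v) :
    plost t v v' = ENNReal.ofReal (∏ c, wordLoss t (v c) (v' c)) := by
  rw [mem_lossy] at h
  simp only [plost, wordLoss, chansSize, Finset.prod_mul_distrib, Nat.cast_prod]
  rw [← Finset.sum_tsub_distrib _ fun c _ => (h c).length_le, Finset.prod_pow_eq_pow_sum,
    Finset.prod_pow_eq_pow_sum]

theorem plost_pos_iff {t : ℝ} (h0 : 0 < t) (h1 : t < 1) {v v' : Chans C M} :
    0 < plost t v v' ↔ ∀ c, (v' c).Sublist (v c) := by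
  refine ⟨fun h => ?_, fun h => ?_⟩
  · by_contra hno
    rw [← mem_lossy] at hno
    exact h.ne' (plost_eq_zero t hno)
  · have : 0 < 1 - t := by linarith
    refine ENNReal.ofReal_pos.2 (mul_pos (by positivity) ?_)
    exact_mod_cast Finset.prod_pos fun c _ => countEmb_pos_iff.2 (h c)

theorem tsum_plost_mul_prod {t : ℝ} (h0 : 0 < t) (h1 : t < 1) (v : Chans C M)
    (f : C → List M → ℝ) (hf : ∀ c w, 0 ≤ f c w) :
    ∑' v', plost t v v' * ENNReal.ofReal (∏ c, f c (v' c))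
      = ENNReal.ofReal (∏ c, lossSum t (v c) (f c)) := by
  rw [tsum_eq_sum (s := lossy v) fun v' hv' => by rw [plost_eq_zero t hv', zero_mul]]
  simp_rw [← sum_wordLoss]
  rw [Finset.prod_univ_sum, ENNReal.ofReal_sum_of_nonneg fun v' _ =>
    Finset.prod_nonneg fun c _ => mul_nonneg (wordLoss_nonneg h0 h1 _ _) (hf _ _)]
  refine Finset.sum_congr rfl fun v' hv' => ?_
  rw [plost_eq_prod t hv', Finset.prod_mul_distrib,
    ENNReal.ofReal_mul (Finset.prod_nonneg fun c _ => wordLoss_nonneg h0 h1 _ _)]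

theorem tsum_plost {t : ℝ} (h0 : 0 < t) (h1 : t < 1) (v : Chans C M) :
    ∑' v', plost t v v' = 1 := by
  have := tsum_plost_mul_prod h0 h1 v (fun _ _ => 1) (by simp)
  simpa [lossSum_one] using this

theorem tsum_plost_mul_chansSize {t : ℝ} (h0 : 0 < t) (h1 : t < 1) (v : Chans C M) :
    ∑' v', plost t v v' * (chansSize v' : ℝ≥0∞) = ENNReal.ofReal (1 - t) * chansSize v := by
  have key : ∀ c, ∑' v', plost t v v' * ((v' c).length : ℝ≥0∞)
      = ENNReal.ofReal (1 - t) * ((v c).length : ℝ≥0∞) := by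
    intro c
    have h := tsum_plost_mul_prod h0 h1 v (fun d w => if d = c then (w.length : ℝ) else 1)
      (fun d w => by split_ifs <;> positivity)
    have e : ∀ d, lossSum t (v d) (fun w => if d = c then (w.length : ℝ) else 1)
        = if d = c then (1 - t) * (v d).length else 1 := by
      intro d
      split_ifs
      · exact lossSum_length t _
      · exact lossSum_one t _
    simp only [e, Finset.prod_ite_eq', Finset.mem_univ, if_true, ENNReal.ofReal_natCast,
      ENNReal.ofReal_mul (show 0 ≤ 1 - t by linarith)] at h
    exact h
  simp only [chansSize, Nat.cast_sum, Finset.mul_sum]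
  rw [Summable.tsum_finsetSum fun _ _ => ENNReal.summable]
  simp only [key]

end Losses

/-! ## The chain of a finite-memory scheduler -/

section FiniteMemory

open MeasureTheory

omit [DecidableEq M] in
theorem chansSize_applyOp_le (op : LcsOp C M) (w : Chans C M) :
    chansSize (applyOp op w) ≤ chansSize w + 1 := by
  have key : ∀ (c : C) (v : List M), v.length ≤ (w c).length + 1 →
      chansSize (Function.update w c v) ≤ chansSize w + 1 := by
    intro c v hv
    simp only [chansSize]
    rw [← Finset.add_sum_erase _ _ (Finset.mem_univ c),
      ← Finset.add_sum_erase _ (fun d => (w d).length) (Finset.mem_univ c),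
      Finset.sum_congr rfl fun d hd => by
        rw [Function.update_of_ne (Finset.ne_of_mem_erase hd)], Function.update_self]
    omega
  cases op with
  | send c m => exact key c _ (by simp)
  | recv c m => exact key c _ (by simp; omega)
  | internal => exact Nat.le_succ _

theorem NPLCS.stepProb_pos_iff (N : NPLCS Q C M) {s t : Conf Q C M} {δ : LcsRule Q C M} :
    0 < N.stepProb s δ t ↔ N.L.StepVia s δ t := by
  unfold NPLCS.stepProb LCS.StepVia
  split_ifs with h
  · rw [plost_pos_iff N.τ_pos N.τ_lt_one]
    tauto
  · simp only [lt_self_iff_false, false_iff]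
    tauto

theorem Scheduler.tsum_kernel_mul (U : Scheduler N) (a : List (Conf Q C M) × Conf Q C M)
    (F : List (Conf Q C M) × Conf Q C M → ℝ≥0∞) :
    ∑' b, U.kernel a b * F b
      = ∑' w, plost N.τ (applyOp (U.choose a.1 a.2).op a.2.2) w
          * F (a.1 ++ [a.2], (U.choose a.1 a.2).dst, w) := by
  rw [ENNReal.tsum_prod', tsum_eq_single (a.1 ++ [a.2]), ENNReal.tsum_prod',
    tsum_eq_single (U.choose a.1 a.2).dst]
  · refine tsum_congr fun w => ?_
    simp [Scheduler.kernel, NPLCS.stepProb, U.choose_mem, U.choose_enabled]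
  · intro q hq
    simp [Scheduler.kernel, NPLCS.stepProb, hq]
  · intro h hh
    simp [Scheduler.kernel, hh]

/-- The state of the chain of `fm` after a history. -/
def FMScheduler.state (fm : FMScheduler N) (a : List (Conf Q C M) × Conf Q C M) :
    Conf Q C M × fm.Mode :=
  (a.2, a.1.foldl fm.upd fm.init)

/-- The scheduler induced by finite-memory data. -/
def FMScheduler.toScheduler (fm : FMScheduler N) : Scheduler N where
  choose h s := fm.D (h.foldl fm.upd fm.init) s
  choose_mem _ _ := fm.D_mem _ _
  choose_enabled _ _ := fm.D_enabled _ _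

omit [DecidableEq C] [DecidableEq M] in
theorem finite_chansSize_le [Fintype M] (K : ℕ) : {w : Chans C M | chansSize w ≤ K}.Finite := by
  refine (Set.Finite.pi' fun _ : C => List.finite_length_le M K).subset fun w hw c => ?_
  exact (Finset.single_le_sum (f := fun c => (w c).length) (fun _ _ => Nat.zero_le _)
    (Finset.mem_univ c)).trans hw

omit [DecidableEq C] [DecidableEq M] in
theorem chansSize_eps : chansSize (eps C M) = 0 := by simp [chansSize, eps]

/-- The history chain of a finite-memory scheduler is a tame lift of its chain on modes. -/
noncomputable def FMScheduler.isTameLift [Fintype Q] [Fintype M] (fm : FMScheduler N)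
    (q : Q) :
    IsTameLift fm.toScheduler.kernel fm.kernel fm.state ([], q, eps C M) where
  lift := by
    rintro ⟨h, s⟩ ⟨t, u⟩ hpos
    have hu : u = fm.upd (h.foldl fm.upd fm.init) s := by
      by_contra hu
      simp [FMScheduler.kernel, FMScheduler.state, hu] at hpos
    exact ⟨(h ++ [s], t), by simp [FMScheduler.state, hu],
      by simp [FMScheduler.kernel, FMScheduler.state, Scheduler.kernel,
        FMScheduler.toScheduler, hu]⟩
  proj := by
    rintro ⟨h, s⟩ ⟨h', t⟩ hpos
    have hu : h' = h ++ [s] := by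
      by_contra hu
      simp [Scheduler.kernel, hu] at hpos
    simpa [FMScheduler.kernel, FMScheduler.state, Scheduler.kernel,
        FMScheduler.toScheduler, hu] using hpos
  prob a := by
    have := fm.toScheduler.tsum_kernel_mul a 1
    simpa [tsum_plost N.τ_pos N.τ_lt_one] using this
  V a := chansSize a.2.2
  r := ENNReal.ofReal (1 - N.τ)
  c := ENNReal.ofReal ((1 - N.τ) / N.τ)
  c_ne_top := ENNReal.ofReal_ne_top
  start := by simp [chansSize_eps]
  stable := by
    have h0 := N.τ_pos
    have h1 := N.τ_lt_one
    have h2 : 0 < 1 - N.τ := by linarith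
    rw [← ENNReal.ofReal_one, ← ENNReal.ofReal_add (by positivity) one_pos.le,
      ← ENNReal.ofReal_mul h2.le]
    refine ENNReal.ofReal_le_ofReal (le_of_eq ?_)
    field_simp
    ring
  drift a := by
    rw [Scheduler.tsum_kernel_mul]
    simp only
    rw [tsum_plost_mul_chansSize N.τ_pos N.τ_lt_one]
    gcongr
    exact_mod_cast chansSize_applyOp_le _ _
  finite K := by
    have := fm.modeFin
    refine (((Set.finite_univ (α := Q)).prod (finite_chansSize_le (C := C) (M := M) K)).prod
      (Set.finite_univ (α := fm.Mode))).subset ?_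
    rintro _ ⟨a, ha, rfl⟩
    have hK : (chansSize a.2.2 : ℝ≥0∞) ≤ K := ha
    exact ⟨⟨trivial, by exact_mod_cast hK⟩, trivial⟩

/-- The states of the chain of `fm` with location in `A i`. -/
def FMScheduler.locSets {ι : Type} (fm : FMScheduler N) (A : ι → Set Q) (i : ι) :
    Set (Conf Q C M × fm.Mode) :=
  {y | y.1.1 ∈ A i}

/-- A state from which all the sets `A i` remain reachable can be reached from `s`. -/
def FMScheduler.ReachesRecurrent {ι : Type} (fm : FMScheduler N) (A : ι → Set Q)
    (s : Conf Q C M) : Prop :=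
  ∃ a, chainReach fm.kernel (s, fm.init) a ∧ Recurrent fm.kernel (fm.locSets A) a

theorem FMScheduler.exists_chainLaw [Fintype Q] [Fintype M] (fm : FMScheduler N) (q : Q)
    {ι : Type} (A : ι → Set Q) :
    ∃ (_ : MeasurableSpace (List (Conf Q C M) × Conf Q C M))
      (_ : DiscreteMeasurableSpace (List (Conf Q C M) × Conf Q C M))
      (μ : Measure (ℕ → List (Conf Q C M) × Conf Q C M)),
      IsChainLaw fm.toScheduler.kernel ([], q, eps C M) μ ∧
      fm.toScheduler.Pr (q, eps C M) (⋂ i, evInfOften (inLoc (A i)))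
        = μ {ω | ∀ i, ∃ᶠ n in Filter.atTop, fm.state (ω n) ∈ fm.locSets A i} := by
  let _ : MeasurableSpace (List (Conf Q C M) × Conf Q C M) := ⊤
  have hd : DiscreteMeasurableSpace (List (Conf Q C M) × Conf Q C M) := ⟨fun _ => trivial⟩
  obtain ⟨μ, hμ⟩ := exists_isChainLaw (fm.isTameLift q).prob ([], q, eps C M)
  refine ⟨_, hd, μ, hμ, ?_⟩
  rw [Scheduler.Pr, hμ.chainPr_eq]
  congr 1
  ext ω
  simp [evInfOften, inLoc, Filter.frequently_atTop, FMScheduler.state, FMScheduler.locSets]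

theorem FMScheduler.reachesRecurrent_of_pr_pos [Fintype Q] [Fintype M] (fm : FMScheduler N) (q : Q)
    {ι : Type} (A : ι → Set Q)
    (h : 0 < fm.toScheduler.Pr (q, eps C M) (⋂ i, evInfOften (inLoc (A i)))) :
    fm.ReachesRecurrent A (q, eps C M) := by
  have := fm.modeFin
  obtain ⟨_, _, μ, hμ, hpr⟩ := fm.exists_chainLaw q A
  exact (fm.isTameLift q).exists_recurrent hμ (hpr ▸ h.ne')

theorem FMScheduler.pr_pos_of_reachesRecurrent [Fintype Q] [Fintype M] (fm : FMScheduler N) (q : Q)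
    {ι : Type} (A : ι → Set Q) (h : fm.ReachesRecurrent A (q, eps C M)) :
    0 < fm.toScheduler.Pr (q, eps C M) (⋂ i, evInfOften (inLoc (A i))) := by
  have := fm.modeFin
  obtain ⟨_, _, μ, hμ, hpr⟩ := fm.exists_chainLaw q A
  obtain ⟨a, h1, h2⟩ := h
  exact hpr ▸ (fm.isTameLift q).measure_pos hμ h1 h2

theorem FMScheduler.pr_eq_one [Fintype Q] [Fintype M] (fm : FMScheduler N) (q : Q)
    {ι : Type} (A : ι → Set Q)
    (h : Recurrent fm.kernel (fm.locSets A) ((q, eps C M), fm.init)) :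
    fm.toScheduler.Pr (q, eps C M) (⋂ i, evInfOften (inLoc (A i))) = 1 := by
  have := fm.modeFin
  obtain ⟨_, _, μ, hμ, hpr⟩ := fm.exists_chainLaw q A
  exact hpr ▸ (fm.isTameLift q).measure_eq_one hμ h

omit [DecidableEq C] [Fintype C] [DecidableEq M] in
theorem Scheduler.FiniteMemory.exists_eq {U : Scheduler N} (h : U.FiniteMemory) :
    ∃ fm : FMScheduler N, U = fm.toScheduler := by
  obtain ⟨fm, hfm⟩ := h
  refine ⟨fm, ?_⟩
  cases U
  congr
  funext h s
  exact hfm h s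

omit [DecidableEq C] [Fintype C] [DecidableEq M] in
theorem FMScheduler.finiteMemory (fm : FMScheduler N) : fm.toScheduler.FiniteMemory :=
  ⟨fm, fun _ _ => rfl⟩

/-- `fm` started in mode `u`. -/
def FMScheduler.startIn (fm : FMScheduler N) (u : fm.Mode) : FMScheduler N :=
  { fm with init := u }

theorem Recurrent.of_reach {S ι : Type} {k : S → S → ℝ≥0∞} {B : ι → Set S} {a b : S}
    (h : Recurrent k B a) (hab : chainReach k a b) : Recurrent k B b :=
  fun c hbc => h c (hab.trans hbc)

theorem FMScheduler.step_of_kernel_pos (fm : FMScheduler N) {a b : Conf Q C M × fm.Mode}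
    (h : 0 < fm.kernel a b) : N.L.Step a.1 b.1 := by
  unfold FMScheduler.kernel at h
  split_ifs at h with hb
  · exact ⟨_, N.stepProb_pos_iff.1 h⟩
  · exact absurd h (lt_irrefl _)

theorem FMScheduler.reach_of_chainReach (fm : FMScheduler N) {a b : Conf Q C M × fm.Mode}
    (h : chainReach fm.kernel a b) : N.L.Reach a.1 b.1 := by
  induction h with
  | refl => exact .refl
  | tail _ hbc ih => exact ih.tail (fm.step_of_kernel_pos hbc)

theorem FMScheduler.exists_kernel_pos_eps (fm : FMScheduler N) (a : Conf Q C M × fm.Mode) :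
    ∃ (x : Q) (u : fm.Mode), 0 < fm.kernel a ((x, eps C M), u) := by
  refine ⟨(fm.D a.2 a.1).dst, fm.upd a.2 a.1, ?_⟩
  rw [FMScheduler.kernel, if_pos rfl, N.stepProb_pos_iff]
  exact ⟨fm.D_mem _ _, fm.D_enabled _ _, rfl, fun c => List.nil_sublist _⟩

omit [DecidableEq C] [Fintype C] [DecidableEq M] in
theorem NPLCS.exists_enabled (N : NPLCS Q C M) (s : Conf Q C M) :
    ∃ δ ∈ N.L.rules, δ.EnabledIn s := by
  obtain ⟨δ, hδ, hs, hr⟩ := N.L.noDeadlock s.1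
  refine ⟨δ, hδ, hs, ?_⟩
  cases hop : δ.op with
  | recv c m => exact absurd (by rw [hop]; trivial) hr
  | send c m => trivial
  | internal => trivial

/-- Fire the rules chosen by `d` in the first step, then behave as `fm`. -/
def FMScheduler.prepend (fm : FMScheduler N) (d : Conf Q C M → LcsRule Q C M)
    (hd : ∀ s, d s ∈ N.L.rules) (hd' : ∀ s, (d s).EnabledIn s) : FMScheduler N where
  Mode := Option fm.Mode
  modeFin := have := fm.modeFin; inferInstance
  init := none
  D u s := u.elim (d s) fun v => fm.D v s
  upd u s := some (u.elim fm.init fun v => fm.upd v s)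
  D_mem u s := by cases u; exacts [hd s, fm.D_mem _ _]
  D_enabled u s := by cases u; exacts [hd' s, fm.D_enabled _ _]

section Prepend

variable (fm : FMScheduler N) {d : Conf Q C M → LcsRule Q C M}
  (hd : ∀ s, d s ∈ N.L.rules) (hd' : ∀ s, (d s).EnabledIn s)

theorem FMScheduler.prepend_kernel_some (s t : Conf Q C M) (u v : fm.Mode) :
    (fm.prepend d hd hd').kernel (s, some u) (t, some v) = fm.kernel (s, u) (t, v) := by
  simp only [FMScheduler.kernel, FMScheduler.prepend, Option.elim_some, Option.some_inj]

theorem FMScheduler.prepend_kernel_none (s t : Conf Q C M) :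
    (fm.prepend d hd hd').kernel (s, none) (t, some fm.init) = N.stepProb s (d s) t :=
  if_pos rfl

theorem FMScheduler.chainReach_prepend {a b : Conf Q C M × fm.Mode}
    (h : chainReach fm.kernel a b) :
    chainReach (fm.prepend d hd hd').kernel (a.1, some a.2) (b.1, some b.2) := by
  induction h with
  | refl => exact .refl
  | tail _ hbc ih => exact ih.tail (by rwa [fm.prepend_kernel_some hd hd'])

theorem FMScheduler.exists_of_chainReach_prepend {a : Conf Q C M × fm.Mode}
    {b : Conf Q C M × Option fm.Mode}
    (h : chainReach (fm.prepend d hd hd').kernel (a.1, some a.2) b) :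
    ∃ u, b.2 = some u ∧ chainReach fm.kernel a (b.1, u) := by
  induction h with
  | refl => exact ⟨a.2, rfl, .refl⟩
  | @tail b c _ hbc ih =>
    obtain ⟨u, hu, hau⟩ := ih
    obtain ⟨t, m⟩ := b
    obtain ⟨t', m'⟩ := c
    cases m' with
    | none => simp [FMScheduler.kernel, FMScheduler.prepend] at hbc
    | some v =>
      obtain rfl : m = some u := hu
      exact ⟨v, rfl, hau.tail (hbc.trans_eq (fm.prepend_kernel_some hd hd' t t' u v))⟩

theorem FMScheduler.recurrent_prepend {ι : Type} {A : ι → Set Q} {a : Conf Q C M × fm.Mode}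
    (h : Recurrent fm.kernel (fm.locSets A) a) :
    Recurrent (fm.prepend d hd hd').kernel ((fm.prepend d hd hd').locSets A)
      (a.1, some a.2) := by
  rintro ⟨t, m⟩ hb i
  obtain ⟨u, rfl, hau⟩ := fm.exists_of_chainReach_prepend hd hd' hb
  obtain ⟨c, hc, huc⟩ := h _ hau i
  exact ⟨(c.1, some c.2), hc, fm.chainReach_prepend hd hd' huc⟩

end Prepend

theorem FMScheduler.ReachesRecurrent.of_step {ι : Type} {A : ι → Set Q} {s t : Conf Q C M}
    {fm : FMScheduler N} (h : fm.ReachesRecurrent A t) (hst : N.L.Step s t) :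
    ∃ fm' : FMScheduler N, fm'.ReachesRecurrent A s := by
  obtain ⟨δ, hδ⟩ := hst
  choose d hd hd' using N.exists_enabled
  have hu : ∀ x, Function.update d s δ x ∈ N.L.rules := fun x => by
    rcases eq_or_ne x s with rfl | hx
    · rw [Function.update_self]; exact hδ.1
    · rw [Function.update_of_ne hx]; exact hd x
  have hu' : ∀ x, (Function.update d s δ x).EnabledIn x := fun x => by
    rcases eq_or_ne x s with rfl | hx
    · rw [Function.update_self]; exact hδ.2.1
    · rw [Function.update_of_ne hx]; exact hd' x
  obtain ⟨a, hta, ha⟩ := h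
  refine ⟨fm.prepend _ hu hu', _, ?_, fm.recurrent_prepend hu hu' ha⟩
  refine Relation.ReflTransGen.head ?_ (fm.chainReach_prepend hu hu' hta)
  refine lt_of_lt_of_eq (N.stepProb_pos_iff.2 ?_) (fm.prepend_kernel_none hu hu' s t).symm
  rwa [Function.update_self]

theorem FMScheduler.ReachesRecurrent.of_reach {ι : Type} {A : ι → Set Q} {s t : Conf Q C M}
    {fm : FMScheduler N} (h : fm.ReachesRecurrent A t) (hst : N.L.Reach s t) :
    ∃ fm' : FMScheduler N, fm'.ReachesRecurrent A s := by
  induction hst using Relation.ReflTransGen.head_induction_on with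
  | refl => exact ⟨fm, h⟩
  | head hab _ ih =>
    obtain ⟨fm', hfm'⟩ := ih
    exact hfm'.of_step hab

end FiniteMemory

/-- A finite-memory scheduler satisfies `⋀ᵢ □◇Aᵢ` with positive probability
from `(q,ε)` iff some `(x,ε)` is reachable from `(q,ε)` from which a
finite-memory scheduler satisfies `⋀ᵢ □◇Aᵢ` almost surely. -/
theorem statement14 {Q C M : Type} [Fintype Q] [Fintype C] [DecidableEq C]
    [Fintype M] [DecidableEq M] (N : NPLCS Q C M) (q : Q) (n : ℕ)
    (A : Fin n → Set Q) :
    (∃ U : Scheduler N, U.FiniteMemory ∧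
        0 < U.Pr (q, eps C M) (⋂ i, evInfOften (inLoc (A i))))
    ↔ ∃ x : Q, N.L.Reach (q, eps C M) (x, eps C M) ∧
        ∃ V : Scheduler N, V.FiniteMemory ∧
          V.Pr (x, eps C M) (⋂ i, evInfOften (inLoc (A i))) = 1 := by
  constructor
  · rintro ⟨U, hU, hpos⟩
    obtain ⟨fm, rfl⟩ := hU.exists_eq
    obtain ⟨a, hqa, ha⟩ := fm.reachesRecurrent_of_pr_pos q A hpos
    obtain ⟨x, u, hax⟩ := fm.exists_kernel_pos_eps a
    have hax' : chainReach fm.kernel a ((x, eps C M), u) := .single hax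
    exact ⟨x, fm.reach_of_chainReach (hqa.trans hax'), (fm.startIn u).toScheduler,
      (fm.startIn u).finiteMemory, (fm.startIn u).pr_eq_one x A (ha.of_reach hax')⟩
  · rintro ⟨x, hqx, V, hV, hone⟩
    obtain ⟨fm, rfl⟩ := hV.exists_eq
    have h := fm.reachesRecurrent_of_pr_pos x A (hone ▸ one_pos)
    obtain ⟨fm', hfm'⟩ := h.of_reach hqx
    exact ⟨fm'.toScheduler, fm'.finiteMemory, fm'.pr_pos_of_reachesRecurrent q A hfm'⟩

end NPLCSmodel
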